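/- Let n, r ≥ 2 be integers and suppose that C_r(Mat_m(k)) is irreducible in the Zariski topology for every integer 1 ≤ m < n. If C_r(N_n) is irreducible, then C_r(Mat_n(k)) is irreducible. -/

import Mathlib

open MvPolynomial Matrix TopologicalSpace

/-- The Zariski topology on `r`-tuples of `n × n` matrices over `k`, identified with
affine space `k^(r·n²)`: the topology generated by complements of hypersurfaces
(its closed sets are exactly the common zero loci of families of polynomials in the
matrix entries). -/
noncomputable def matTupleZariski (k : Type*) [CommRing k] (n r : ℕ) :
    TopologicalSpace (Fin r → Matrix (Fin n) (Fin n) k) :=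
  TopologicalSpace.generateFrom
    {U | ∃ p : MvPolynomial (Fin r × Fin n × Fin n) k,
      U = {x | MvPolynomial.eval (fun q => x q.1 q.2.1 q.2.2) p ≠ 0}}

/-- `C_r(N_n)`: the set of commuting `r`-tuples of nilpotent `n × n` matrices. -/
def nilCommTuples (k : Type*) [Field k] (n r : ℕ) :
    Set (Fin r → Matrix (Fin n) (Fin n) k) :=
  {x | (∀ i, IsNilpotent (x i)) ∧ ∀ i j, x i * x j = x j * x i}

/-- `C_r(Mat_n(k))`: the set of commuting `r`-tuples of `n × n` matrices. -/
def commTuples (k : Type*) [Field k] (n r : ℕ) :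
    Set (Fin r → Matrix (Fin n) (Fin n) k) :=
  {x | ∀ i j, x i * x j = x j * x i}

section RegularFunctions

variable {k X : Type*} [Field k] {ι κ μ : Type*}

/-- A matrix-valued function all of whose entries belong to the function algebra `A`. -/
def EntriesMem (A : Subalgebra k (X → k)) (M : X → Matrix ι μ k) : Prop :=
  ∀ i j, (fun x => M x i j) ∈ A

variable {A : Subalgebra k (X → k)}

theorem sum_fun_mem {s : Finset κ} {f : κ → X → k} (hf : ∀ i, f i ∈ A) :
    (fun x => ∑ i ∈ s, f i x) ∈ A := by
  have : (fun x => ∑ i ∈ s, f i x) = ∑ i ∈ s, f i := by ext x; simp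
  rw [this]
  exact sum_mem fun i _ => hf i

theorem const_fun_mem (c : k) : (fun _ => c) ∈ A := A.algebraMap_mem c

theorem EntriesMem.const (M : Matrix ι μ k) : EntriesMem A fun _ => M :=
  fun i j => const_fun_mem (M i j)

theorem EntriesMem.add {M N : X → Matrix ι μ k} (hM : EntriesMem A M) (hN : EntriesMem A N) :
    EntriesMem A fun x => M x + N x :=
  fun i j => A.add_mem (hM i j) (hN i j)

theorem EntriesMem.smul {f : X → k} {M : X → Matrix ι μ k} (hf : f ∈ A) (hM : EntriesMem A M) :
    EntriesMem A fun x => f x • M x :=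
  fun i j => A.mul_mem hf (hM i j)

variable [Fintype κ]

theorem EntriesMem.sum {M : κ → X → Matrix ι μ k} (hM : ∀ c, EntriesMem A (M c)) :
    EntriesMem A fun x => ∑ c, M c x := by
  intro i j
  simp only [Matrix.sum_apply]
  exact sum_fun_mem fun c => hM c i j

theorem EntriesMem.mul {M : X → Matrix ι κ k} {N : X → Matrix κ μ k} (hM : EntriesMem A M)
    (hN : EntriesMem A N) : EntriesMem A fun x => M x * N x :=
  fun i j => sum_fun_mem fun c => A.mul_mem (hM i c) (hN c j)

theorem EntriesMem.pow [DecidableEq κ] {M : X → Matrix κ κ k} (hM : EntriesMem A M) (j : ℕ) :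
    EntriesMem A fun x => M x ^ j := by
  induction j with
  | zero => simp [EntriesMem.const]
  | succ j ih => simpa only [pow_succ] using ih.mul hM

theorem EntriesMem.det [DecidableEq κ] {M : X → Matrix κ κ k} (hM : EntriesMem A M) :
    (fun x => (M x).det) ∈ A := by
  simp only [Matrix.det_apply']
  refine sum_fun_mem fun σ => A.mul_mem (const_fun_mem _) ?_
  have : (fun x => ∏ i, M x (σ i) i) = ∏ i, fun x => M x (σ i) i := by ext x; simp
  rw [this]
  exact prod_mem fun i _ => hM _ _

theorem EntriesMem.fromBlocks {m m' : Type*} {M : X → Matrix m m k} {N : X → Matrix m' m' k}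
    (hM : EntriesMem A M) (hN : EntriesMem A N) :
    EntriesMem A fun x => Matrix.fromBlocks (M x) 0 0 (N x) := by
  rintro (i | i) (j | j)
  exacts [hM i j, const_fun_mem 0, const_fun_mem 0, hN i j]

variable (k) in
/-- The algebra of polynomial functions on `r`-tuples of `n × n` matrices. -/
noncomputable def regularFun (n r : ℕ) : Subalgebra k ((Fin r → Matrix (Fin n) (Fin n) k) → k) :=
  (MvPolynomial.aeval fun (q : Fin r × Fin n × Fin n) x => x q.1 q.2.1 q.2.2).range

variable {n r : ℕ}

theorem aeval_fun_apply {σ : Type*} (g : σ → X → k) (p : MvPolynomial σ k) (x : X) :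
    MvPolynomial.aeval g p x = MvPolynomial.eval (fun q => g q x) p := by
  have : (Pi.evalAlgHom k (fun _ : X => k) x).comp (MvPolynomial.aeval g) =
      MvPolynomial.aeval fun q => g q x := by
    ext q; simp
  simpa [MvPolynomial.coe_aeval_eq_eval] using DFunLike.congr_fun this p

theorem mem_regularFun {f : (Fin r → Matrix (Fin n) (Fin n) k) → k} :
    f ∈ regularFun k n r ↔ ∃ p : MvPolynomial (Fin r × Fin n × Fin n) k,
      ∀ x, f x = MvPolynomial.eval (fun q => x q.1 q.2.1 q.2.2) p := by
  constructor
  · rintro ⟨p, rfl⟩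
    exact ⟨p, fun x => aeval_fun_apply _ p x⟩
  · rintro ⟨p, hp⟩
    have hf : f = MvPolynomial.aeval
        (fun (q : Fin r × Fin n × Fin n) x => x q.1 q.2.1 q.2.2) p := by
      ext x
      rw [hp, aeval_fun_apply]
    rw [hf]
    exact AlgHom.mem_range_self _ p

theorem entriesMem_coord (i : Fin r) : EntriesMem (regularFun k n r) fun x => x i :=
  fun a b => mem_regularFun.2 ⟨MvPolynomial.X (i, a, b), fun x => by simp⟩

theorem comp_mem_of_regularFun {f : (Fin r → Matrix (Fin n) (Fin n) k) → k}
    (hf : f ∈ regularFun k n r) {ψ : X → Fin r → Matrix (Fin n) (Fin n) k}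
    (hψ : ∀ i, EntriesMem A fun x => ψ x i) : (fun x => f (ψ x)) ∈ A := by
  obtain ⟨p, hp⟩ := mem_regularFun.1 hf
  have : (fun x => f (ψ x)) = MvPolynomial.aeval
      (fun (q : Fin r × Fin n × Fin n) x => ψ x q.1 q.2.1 q.2.2) p := by
    ext x
    rw [hp, aeval_fun_apply]
  rw [this]
  have hr := MvPolynomial.aeval_range (R := k)
    fun (q : Fin r × Fin n × Fin n) (x : X) => ψ x q.1 q.2.1 q.2.2
  refine (Algebra.adjoin_le ?_ : _ ≤ A) (hr ▸ AlgHom.mem_range_self _ p)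
  rintro _ ⟨q, rfl⟩
  exact hψ _ _ _

theorem isIrreducible_matTupleZariski_iff {S : Set (Fin r → Matrix (Fin n) (Fin n) k)} :
    (letI := matTupleZariski k n r; IsIrreducible S) ↔ S.Nonempty ∧
      ∀ f ∈ regularFun k n r, ∀ g ∈ regularFun k n r, (∀ x ∈ S, f x * g x = 0) →
        (∀ x ∈ S, f x = 0) ∨ ∀ x ∈ S, g x = 0 := by
  let := matTupleZariski k n r
  have hb : IsTopologicalBasis {U : Set (Fin r → Matrix (Fin n) (Fin n) k) |
      ∃ p : MvPolynomial (Fin r × Fin n × Fin n) k,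
        U = {x | MvPolynomial.eval (fun q => x q.1 q.2.1 q.2.2) p ≠ 0}} := by
    refine ⟨?_, ?_, rfl⟩
    · rintro _ ⟨p, rfl⟩ _ ⟨q, rfl⟩ x hx
      refine ⟨_, ⟨p * q, rfl⟩, by simpa using hx, fun y hy => by simpa using hy⟩
    · exact Set.eq_univ_of_forall fun x => ⟨_, ⟨1, rfl⟩, by simp⟩
  refine and_congr_right fun _ => ⟨fun hS f hf g hg hfg => ?_, fun hS U V hU hV => ?_⟩
  · obtain ⟨p, hp⟩ := mem_regularFun.1 hf
    obtain ⟨q, hq⟩ := mem_regularFun.1 hg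
    by_contra! hne
    obtain ⟨⟨x, hx, hxf⟩, y, hy, hyg⟩ := hne
    obtain ⟨z, hz, hzf, hzg⟩ := hS _ _ (hb.isOpen ⟨p, rfl⟩) (hb.isOpen ⟨q, rfl⟩)
      ⟨x, hx, by rwa [Set.mem_ofPred_eq, ← hp]⟩ ⟨y, hy, by rwa [Set.mem_ofPred_eq, ← hq]⟩
    rw [Set.mem_ofPred_eq, ← hp] at hzf
    rw [Set.mem_ofPred_eq, ← hq] at hzg
    exact mul_ne_zero hzf hzg (hfg z hz)
  · rintro ⟨x, hx, hxU⟩ ⟨y, hy, hyV⟩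
    obtain ⟨_, ⟨p, rfl⟩, hxp, hpU⟩ := hb.exists_subset_of_mem_open hxU hU
    obtain ⟨_, ⟨q, rfl⟩, hyq, hqV⟩ := hb.exists_subset_of_mem_open hyV hV
    by_contra hne
    rcases hS _ (mem_regularFun.2 ⟨p, fun _ => rfl⟩) _ (mem_regularFun.2 ⟨q, fun _ => rfl⟩)
      (fun z hz => by
        by_contra h0
        obtain ⟨hp, hq⟩ := mul_ne_zero_iff.1 h0
        exact hne ⟨z, hz, hpU hp, hqV hq⟩) with h | h
    exacts [hxp (h x hx), hyq (h y hy)]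

end RegularFunctions

section PolynomialTuples

variable {k : Type*} [Field k] {n r : ℕ}

variable (k n r) in
/-- The tuples all of whose members are polynomials in one common matrix. -/
def polyTuples : Set (Fin r → Matrix (Fin n) (Fin n) k) :=
  {x | ∃ (y : Matrix (Fin n) (Fin n) k) (c : Fin r → Fin n → k),
    x = fun i => ∑ j, c i j • y ^ (j : ℕ)}

theorem polyTuples_mul_eq_zero [Infinite k] {f g : (Fin r → Matrix (Fin n) (Fin n) k) → k}
    (hf : f ∈ regularFun k n r) (hg : g ∈ regularFun k n r)
    (hfg : ∀ x ∈ polyTuples k n r, f x * g x = 0) :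
    (∀ x ∈ polyTuples k n r, f x = 0) ∨ ∀ x ∈ polyTuples k n r, g x = 0 := by
  by_contra! hne
  obtain ⟨⟨_, ⟨y, c, rfl⟩, hx⟩, _, ⟨z, d, rfl⟩, hz⟩ := hne
  let A : Subalgebra k (k → k) := (Polynomial.aeval (id : k → k)).range
  have hA : ∀ φ ∈ A, ∃ p : Polynomial k, ∀ t, φ t = p.eval t := by
    rintro _ ⟨p, rfl⟩
    refine ⟨p, fun t => ?_⟩
    have : (Pi.evalAlgHom k (fun _ : k => k) t).comp (Polynomial.aeval id) =
      Polynomial.aeval t := by ext; simp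
    rw [← Polynomial.coe_aeval_eq_eval, ← this]
    rfl
  have hid : (fun t : k => t) ∈ A := ⟨Polynomial.X, by simp; rfl⟩
  let ψ : k → Fin r → Matrix (Fin n) (Fin n) k := fun t i =>
    ∑ j, (c i j + t * (d i j - c i j)) • (y + t • (z - y)) ^ (j : ℕ)
  have hψ : ∀ i, EntriesMem A fun t => ψ t i := fun i =>
    .sum fun j => .smul
      (A.add_mem (const_fun_mem _) (A.mul_mem hid (const_fun_mem _)))
      (((EntriesMem.const _).add (.smul hid (.const _))).pow _)
  obtain ⟨p, hp⟩ := hA _ (comp_mem_of_regularFun hf hψ)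
  obtain ⟨q, hq⟩ := hA _ (comp_mem_of_regularFun hg hψ)
  have hpq : p * q = 0 := Polynomial.funext fun t => by
    rw [Polynomial.eval_mul, ← hp, ← hq, Polynomial.eval_zero]
    exact hfg _ ⟨_, _, rfl⟩
  rcases mul_eq_zero.1 hpq with rfl | rfl
  · refine hx ?_
    simpa [ψ] using hp 0
  · refine hz ?_
    simpa [ψ] using hq 1

/-- The matrix with columns `v, y v, …, y ^ (n - 1) v`. -/
def krylov (v : Fin n → k) (y : Matrix (Fin n) (Fin n) k) : Matrix (Fin n) (Fin n) k :=
  Matrix.of fun i j => (y ^ (j : ℕ) *ᵥ v) i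

theorem EntriesMem.krylov {X : Type*} {A : Subalgebra k (X → k)} (v : Fin n → k)
    {y : X → Matrix (Fin n) (Fin n) k} (hy : EntriesMem A y) :
    EntriesMem A fun x => _root_.krylov v (y x) := by
  intro i j
  simp only [_root_.krylov, Matrix.of_apply, Matrix.mulVec, dotProduct]
  exact sum_fun_mem fun c => A.mul_mem (hy.pow j i c) (const_fun_mem _)

theorem krylov_mulVec (v c : Fin n → k) (y : Matrix (Fin n) (Fin n) k) :
    krylov v y *ᵥ c = (∑ j, c j • y ^ (j : ℕ)) *ᵥ v := by
  ext i
  rw [Matrix.sum_mulVec]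
  simp [krylov, Matrix.mulVec, dotProduct, mul_comm, Finset.mul_sum, mul_left_comm]

theorem eq_zero_of_mulVec_eq_zero {v : Fin n → k} {y z : Matrix (Fin n) (Fin n) k}
    (hv : (krylov v y).det ≠ 0) (hzy : Commute z y) (hz : z *ᵥ v = 0) : z = 0 := by
  have h0 : z * krylov v y = 0 := by
    ext i j
    change (z *ᵥ (y ^ (j : ℕ) *ᵥ v)) i = 0
    rw [Matrix.mulVec_mulVec, (hzy.pow_right _).eq, ← Matrix.mulVec_mulVec, hz]
    simp
  have hu : IsUnit (krylov v y) := (Matrix.isUnit_iff_isUnit_det _).2 hv.isUnit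
  exact hu.mul_left_eq_zero.1 h0

theorem exists_eq_sum_pow {v : Fin n → k} {y z : Matrix (Fin n) (Fin n) k}
    (hv : (krylov v y).det ≠ 0) (hzy : Commute z y) :
    ∃ c : Fin n → k, z = ∑ j, c j • y ^ (j : ℕ) := by
  refine ⟨(krylov v y)⁻¹ *ᵥ (z *ᵥ v), ?_⟩
  rw [← sub_eq_zero]
  refine eq_zero_of_mulVec_eq_zero hv ?_ ?_
  · exact hzy.sub_left (.sum_left _ _ _ fun j _ => .smul_left (Commute.pow_left rfl _) _)
  · rw [Matrix.sub_mulVec, ← krylov_mulVec, Matrix.mulVec_mulVec,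
      Matrix.mul_nonsing_inv _ hv.isUnit, Matrix.one_mulVec, sub_self]

theorem mem_polyTuples_of_commute {v : Fin n → k} {y : Matrix (Fin n) (Fin n) k}
    {x : Fin r → Matrix (Fin n) (Fin n) k} (hv : (krylov v y).det ≠ 0)
    (hx : ∀ i, Commute (x i) y) : x ∈ polyTuples k n r := by
  choose c hc using fun i => exists_eq_sum_pow hv (hx i)
  exact ⟨y, c, funext hc⟩

theorem polyTuples_subset_commTuples : polyTuples k n r ⊆ commTuples k n r := by
  rintro _ ⟨y, c, rfl⟩ i j
  exact Commute.sum_left _ _ _ fun a _ => .sum_right _ _ _ fun b _ =>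
    .smul_left (.smul_right (Commute.pow_pow rfl _ _) _) _

end PolynomialTuples

section Nilpotent

variable {k : Type*} [Field k] {n r : ℕ}

theorem exists_isNilpotent_krylov_eq_one : ∃ (v : Fin n → k)
    (y : Matrix (Fin n) (Fin n) k), IsNilpotent y ∧ krylov v y = 1 := by
  let v : ℕ → Fin n → k := fun j i => if (i : ℕ) = j then 1 else 0
  let y : Matrix (Fin n) (Fin n) k := Matrix.of fun i j => if (i : ℕ) = j + 1 then 1 else 0
  have hstep : ∀ j, y *ᵥ v j = v (j + 1) := by
    intro j
    ext i
    by_cases hj : j < n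
    · rw [show v j = Pi.single ⟨j, hj⟩ 1 by
        ext a; simp [v, Pi.single_apply, Fin.ext_iff]]
      simp [y, v]
    · have h0 : v j = 0 := by ext a; simp [v]; omega
      rw [h0]
      simp [v]; omega
  have hpow : ∀ j, y ^ j *ᵥ v 0 = v j := by
    intro j
    induction j with
    | zero => simp
    | succ j ih => rw [pow_succ', ← Matrix.mulVec_mulVec, ih, hstep]
  have hK : krylov (v 0) y = 1 := by
    ext i j
    simp [krylov, hpow, v, Matrix.one_apply, Fin.ext_iff]
  refine ⟨v 0, y, ⟨n, ?_⟩, hK⟩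
  refine eq_zero_of_mulVec_eq_zero (v := v 0) (y := y) (by simp [hK]) (Commute.pow_left rfl _) ?_
  rw [hpow]
  ext i
  simp [v]; omega

theorem eq_zero_of_isNilpotent_sub_scalar (hr : 0 < r)
    (hirr : letI := matTupleZariski k n r; IsIrreducible (nilCommTuples k n r))
    {f : (Fin r → Matrix (Fin n) (Fin n) k) → k} (hf : f ∈ regularFun k n r)
    (hf0 : ∀ x ∈ polyTuples k n r, f x = 0) {x : Fin r → Matrix (Fin n) (Fin n) k}
    (hx : x ∈ commTuples k n r) (c : Fin r → k)
    (hnil : ∀ i, IsNilpotent (x i - Matrix.scalar (Fin n) (c i))) : f x = 0 := by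
  obtain ⟨v, y, hy, hv⟩ := exists_isNilpotent_krylov_eq_one (k := k) (n := n)
  let i₀ : Fin r := ⟨0, hr⟩
  have hscalar : ∀ i (z : Matrix (Fin n) (Fin n) k), Commute (Matrix.scalar (Fin n) (c i)) z :=
    fun i z => Matrix.scalar_commute _ (fun _ => Commute.all _ _) _
  rcases (isIrreducible_matTupleZariski_iff.1 hirr).2
    (fun z => f fun i => z i + Matrix.scalar (Fin n) (c i))
    (comp_mem_of_regularFun hf fun i => (entriesMem_coord i).add (.const _))
    (fun z => (krylov v (z i₀)).det) (EntriesMem.krylov v (entriesMem_coord i₀)).det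
    (fun z hz => by
      by_cases h0 : (krylov v (z i₀)).det = 0
      · simp [h0]
      · rw [hf0 _ (mem_polyTuples_of_commute h0 fun i =>
          Commute.add_left (hz.2 i i₀) (hscalar i _)), zero_mul]) with h | h
  · have := h (fun i => x i - Matrix.scalar (Fin n) (c i)) ⟨hnil, fun i j =>
      ((show Commute (x i) (x j) from hx i j).sub_left (hscalar i _)).sub_right
        (hscalar j _).symm⟩
    simpa using this
  · have := h (fun _ => y) ⟨fun _ => hy, fun _ _ => rfl⟩
    simp [hv] at this

end Nilpotent

section Blocks

variable {k : Type*} [Field k] {n r m m' : ℕ}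

theorem mul_eq_zero_of_isIrreducible
    (hm : letI := matTupleZariski k m r; IsIrreducible (commTuples k m r))
    (hm' : letI := matTupleZariski k m' r; IsIrreducible (commTuples k m' r))
    {F D : (Fin r → Matrix (Fin m) (Fin m) k) → (Fin r → Matrix (Fin m') (Fin m') k) → k}
    (hF₁ : ∀ b, (fun a => F a b) ∈ regularFun k m r) (hF₂ : ∀ a, F a ∈ regularFun k m' r)
    (hD₁ : ∀ b, (fun a => D a b) ∈ regularFun k m r) (hD₂ : ∀ a, D a ∈ regularFun k m' r)
    (hFD : ∀ a ∈ commTuples k m r, ∀ b ∈ commTuples k m' r, F a b * D a b = 0)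
    {a₀ : Fin r → Matrix (Fin m) (Fin m) k} (ha₀ : a₀ ∈ commTuples k m r)
    {b₀ : Fin r → Matrix (Fin m') (Fin m') k} (hb₀ : b₀ ∈ commTuples k m' r)
    (h₀ : D a₀ b₀ ≠ 0) {a : Fin r → Matrix (Fin m) (Fin m) k} (ha : a ∈ commTuples k m r)
    {b : Fin r → Matrix (Fin m') (Fin m') k} (hb : b ∈ commTuples k m' r) : F a b = 0 := by
  refine ((isIrreducible_matTupleZariski_iff.1 hm').2 _ (hF₂ a) _ (hD₂ a₀)
    fun b hb => ?_).resolve_right (fun h => h₀ (h b₀ hb₀)) b hb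
  by_cases h : D a₀ b = 0
  · rw [h, mul_zero]
  · rw [((isIrreducible_matTupleZariski_iff.1 hm).2 _ (hF₁ b) _ (hD₁ b)
      fun a ha => hFD a ha b hb).resolve_right (fun h' => h (h' a₀ ha₀)) a ha, zero_mul]

theorem mul_mul_pow_of_mul_eq_one {ι κ : Type*} [Fintype ι] [Fintype κ]
    [DecidableEq ι] [DecidableEq κ] {P : Matrix ι κ k} {Q : Matrix κ ι k} (hPQ : P * Q = 1) (hQP : Q * P = 1)
    (M : Matrix κ κ k) (j : ℕ) : (P * M * Q) ^ j = P * M ^ j * Q := by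
  induction j with
  | zero => simp [hPQ]
  | succ j ih =>
    rw [pow_succ, ih, pow_succ]
    calc P * M ^ j * Q * (P * M * Q) = P * M ^ j * (Q * P) * M * Q := by
          simp only [Matrix.mul_assoc]
      _ = _ := by rw [hQP, Matrix.mul_one, Matrix.mul_assoc P]

theorem exists_diagonal_krylov_ne_zero [Infinite k] {P : Matrix (Fin n) (Fin m ⊕ Fin m') k}
    {Q : Matrix (Fin m ⊕ Fin m') (Fin n) k} (hPQ : P * Q = 1) (hQP : Q * P = 1)
    (hmn : n = m + m') : ∃ (d : Fin m → k) (d' : Fin m' → k),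
      (krylov (P *ᵥ 1) (P * Matrix.fromBlocks (Matrix.diagonal d) 0 0
        (Matrix.diagonal d') * Q)).det ≠ 0 := by
  let e : Fin n ≃ Fin m ⊕ Fin m' := (finCongr hmn).trans finSumFinEquiv.symm
  let s : Fin m ⊕ Fin m' → k := Infinite.natEmbedding k ∘ (fun i : Fin n => (i : ℕ)) ∘ e.symm
  have hs : Function.Injective s := (Infinite.natEmbedding k).injective.comp
    (Fin.val_injective.comp e.symm.injective)
  refine ⟨s ∘ Sum.inl, s ∘ Sum.inr, ?_⟩
  have hK : krylov (P *ᵥ 1) (P * Matrix.fromBlocks (Matrix.diagonal (s ∘ Sum.inl)) 0 0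
      (Matrix.diagonal (s ∘ Sum.inr)) * Q) =
      P.submatrix id e * Matrix.vandermonde (s ∘ e) := by
    ext i j
    rw [Matrix.mul_apply]
    simp only [krylov, Matrix.of_apply, mul_mul_pow_of_mul_eq_one hPQ hQP,
      Matrix.fromBlocks_diagonal, Sum.elim_comp_inl_inr, Matrix.diagonal_pow]
    rw [Matrix.mulVec_mulVec, Matrix.mul_assoc, hQP, Matrix.mul_one, Matrix.mulVec, dotProduct,
      ← e.sum_comp]
    simp [Matrix.mul_diagonal, Matrix.vandermonde]
  rw [hK, Matrix.det_mul]
  refine mul_ne_zero ?_ (Matrix.det_vandermonde_ne_zero_iff.2 (hs.comp e.injective))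
  have h1 : P.submatrix id e * Q.submatrix e id = 1 := by
    rw [Matrix.submatrix_mul_equiv, hPQ, Matrix.submatrix_id_id]
  exact left_ne_zero_of_mul_eq_one (by rw [← Matrix.det_mul, h1, Matrix.det_one])

theorem eq_zero_of_blocks [Infinite k] (hr : 0 < r) (hmn : n = m + m')
    (hm : letI := matTupleZariski k m r; IsIrreducible (commTuples k m r))
    (hm' : letI := matTupleZariski k m' r; IsIrreducible (commTuples k m' r))
    {f : (Fin r → Matrix (Fin n) (Fin n) k) → k} (hf : f ∈ regularFun k n r)
    (hf0 : ∀ x ∈ polyTuples k n r, f x = 0) {P : Matrix (Fin n) (Fin m ⊕ Fin m') k}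
    {Q : Matrix (Fin m ⊕ Fin m') (Fin n) k} (hPQ : P * Q = 1) (hQP : Q * P = 1)
    {a : Fin r → Matrix (Fin m) (Fin m) k} (ha : a ∈ commTuples k m r)
    {b : Fin r → Matrix (Fin m') (Fin m') k} (hb : b ∈ commTuples k m' r) :
    f (fun i => P * Matrix.fromBlocks (a i) 0 0 (b i) * Q) = 0 := by
  obtain ⟨d, d', hd⟩ := exists_diagonal_krylov_ne_zero hPQ hQP hmn
  let i₀ : Fin r := ⟨0, hr⟩
  let ψ : (Fin r → Matrix (Fin m) (Fin m) k) → (Fin r → Matrix (Fin m') (Fin m') k) →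
      Fin r → Matrix (Fin n) (Fin n) k := fun a b i => P * Matrix.fromBlocks (a i) 0 0 (b i) * Q
  have h₁ : ∀ b i, EntriesMem (regularFun k m r) fun a => ψ a b i := fun b i =>
    ((EntriesMem.const _).mul ((entriesMem_coord i).fromBlocks (.const _))).mul (.const _)
  have h₂ : ∀ a i, EntriesMem (regularFun k m' r) fun b => ψ a b i := fun a i =>
    ((EntriesMem.const _).mul ((EntriesMem.const _).fromBlocks (entriesMem_coord i))).mul
      (.const _)
  refine mul_eq_zero_of_isIrreducible hm hm' (F := fun a b => f (ψ a b))
    (D := fun a b => (krylov (P *ᵥ 1) (ψ a b i₀)).det)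
    (fun b => comp_mem_of_regularFun hf (h₁ b)) (fun a => comp_mem_of_regularFun hf (h₂ a))
    (fun b => ((h₁ b i₀).krylov _).det) (fun a => ((h₂ a i₀).krylov _).det)
    (fun a ha b hb => ?_) (a₀ := fun _ => Matrix.diagonal d) (fun _ _ => rfl)
    (b₀ := fun _ => Matrix.diagonal d') (fun _ _ => rfl) hd ha hb
  by_cases h0 : (krylov (P *ᵥ 1) (ψ a b i₀)).det = 0
  · rw [h0, mul_zero]
  · rw [hf0 _ (mem_polyTuples_of_commute h0 fun i => ?_), zero_mul]
    have key : ∀ M N : Matrix (Fin m ⊕ Fin m') (Fin m ⊕ Fin m') k,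
        P * M * Q * (P * N * Q) = P * (M * N) * Q := fun M N => by
      calc P * M * Q * (P * N * Q) = P * M * (Q * P) * N * Q := by
            simp only [Matrix.mul_assoc]
        _ = _ := by rw [hQP, Matrix.mul_one, Matrix.mul_assoc P]
    simp only [ψ, Commute, SemiconjBy, key, Matrix.fromBlocks_multiply, ha i i₀, hb i i₀]
    simp

theorem exists_block_decomposition {x : Fin r → Matrix (Fin n) (Fin n) k}
    (hx : x ∈ commTuples k n r) {z : Matrix (Fin n) (Fin n) k} (hz : ∀ i, Commute (x i) z)
    (hker : ¬ IsUnit z) (hnil : ¬ IsNilpotent z) :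
    ∃ (m m' : ℕ) (P : Matrix (Fin n) (Fin m ⊕ Fin m') k)
      (Q : Matrix (Fin m ⊕ Fin m') (Fin n) k) (a : Fin r → Matrix (Fin m) (Fin m) k)
      (b : Fin r → Matrix (Fin m') (Fin m') k), 0 < m ∧ 0 < m' ∧ n = m + m' ∧ P * Q = 1 ∧
      Q * P = 1 ∧ a ∈ commTuples k m r ∧ b ∈ commTuples k m' r ∧
      ∀ i, x i = P * Matrix.fromBlocks (a i) 0 0 (b i) * Q := by
  let T : Module.End k (Fin n → k) := Matrix.toLinAlgEquiv' z
  obtain ⟨N, hN⟩ := Filter.eventually_atTop.1 T.eventually_isCompl_ker_pow_range_pow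
  let W := LinearMap.ker (T ^ (N + 1))
  let W' := LinearMap.range (T ^ (N + 1))
  have hc : IsCompl W W' := hN (N + 1) (by omega)
  let B := Module.finBasis k W
  let B' := Module.finBasis k W'
  let E := (B.prod B').map (Submodule.prodEquivOfIsCompl W W' hc)
  let e := Pi.basisFun k (Fin n)
  let L : Fin r → Module.End k (Fin n → k) := fun i => Matrix.toLinAlgEquiv' (x i)
  have hL : ∀ i, Commute (L i) (T ^ (N + 1)) := fun i =>
    Commute.pow_right ((hz i).map Matrix.toLinAlgEquiv') _
  let M : Fin r → Matrix _ _ k := fun i => LinearMap.toMatrix E E (L i)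
  have hW : ∀ i, ∀ w ∈ W, L i w ∈ W := fun i w hw => by
    have := LinearMap.congr_fun (hL i).eq w
    simp only [W, LinearMap.mem_ker, Module.End.mul_apply] at hw this ⊢
    rw [← this, hw, map_zero]
  have hW' : ∀ i, ∀ w ∈ W', L i w ∈ W' := by
    rintro i _ ⟨w, rfl⟩
    exact ⟨L i w, (LinearMap.congr_fun (hL i).eq w).symm⟩
  have h21 : ∀ i, (M i).toBlocks₂₁ = 0 := fun i => by
    ext p q
    have h := (Submodule.projectionOnto_apply_eq_zero_iff hc.symm).2 (hW i _ (B q).2)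
    simp [M, Matrix.toBlocks₂₁, LinearMap.toMatrix_apply, E, h]
  have h12 : ∀ i, (M i).toBlocks₁₂ = 0 := fun i => by
    ext p q
    have h := (Submodule.projectionOnto_apply_eq_zero_iff hc).2 (hW' i _ (B' q).2)
    simp [M, Matrix.toBlocks₁₂, LinearMap.toMatrix_apply, E, h]
  have hM : ∀ i, M i = Matrix.fromBlocks (M i).toBlocks₁₁ 0 0 (M i).toBlocks₂₂ := fun i => by
    conv_lhs => rw [← Matrix.fromBlocks_toBlocks (M i), h21, h12]
  have hcomm : ∀ i j, M i * M j = M j * M i := fun i j => by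
    simp only [M, ← LinearMap.toMatrix_mul]
    congr 1
    exact ((show Commute (x i) (x j) from hx i j).map Matrix.toLinAlgEquiv').eq
  have hblk : ∀ i j, (M i).toBlocks₁₁ * (M j).toBlocks₁₁ = (M j).toBlocks₁₁ * (M i).toBlocks₁₁ ∧
      (M i).toBlocks₂₂ * (M j).toBlocks₂₂ = (M j).toBlocks₂₂ * (M i).toBlocks₂₂ := fun i j => by
    have := hcomm i j
    rw [hM i, hM j, Matrix.fromBlocks_multiply, Matrix.fromBlocks_multiply,
      Matrix.fromBlocks_inj] at this
    simpa using And.intro this.1 this.2.2.2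
  refine ⟨_, _, e.toMatrix E, E.toMatrix e, fun i => (M i).toBlocks₁₁, fun i => (M i).toBlocks₂₂,
    ?_, ?_, ?_, e.toMatrix_mul_toMatrix_flip E, E.toMatrix_mul_toMatrix_flip e,
    fun i j => (hblk i j).1, fun i j => (hblk i j).2, fun i => ?_⟩
  · rw [Module.finrank_pos_iff, Submodule.nontrivial_iff_ne_bot]
    intro hbot
    have h1 : IsUnit (T ^ (N + 1)) := LinearMap.isUnit_iff_ker_eq_bot _ |>.2 hbot
    rw [isUnit_pow_iff (by omega)] at h1
    exact hker ((MulEquiv.isUnit_map Matrix.toLinAlgEquiv').1 h1)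
  · rw [Module.finrank_pos_iff, Submodule.nontrivial_iff_ne_bot]
    intro hbot
    refine hnil ⟨N + 1, Matrix.toLinAlgEquiv'.injective ?_⟩
    rw [map_pow, map_zero]
    exact LinearMap.range_eq_bot.1 hbot
  · simpa using (Submodule.finrank_add_eq_of_isCompl hc).symm
  · rw [← hM]
    simp only [M]
    rw [basis_toMatrix_mul_linearMap_toMatrix_mul_basis_toMatrix]
    ext p q
    simp [L, e]

end Blocks

/-- Let `n, r ≥ 2` and suppose `C_r(Mat_m(k))` is irreducible for every `1 ≤ m < n`.
If `C_r(N_n)` is irreducible, then `C_r(Mat_n(k))` is irreducible. -/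
theorem commTuples_irreducible_of_nilCommTuples_irreducible (k : Type*) [Field k]
    [IsAlgClosed k] (n r : ℕ) (hn : 2 ≤ n) (hr : 2 ≤ r)
    (h : ∀ m : ℕ, 1 ≤ m → m < n →
      letI := matTupleZariski k m r
      IsIrreducible (commTuples k m r)) :
    letI := matTupleZariski k n r
    IsIrreducible (nilCommTuples k n r) → IsIrreducible (commTuples k n r) := by
  intro hnil
  have hvanish : ∀ f ∈ regularFun k n r, (∀ x ∈ polyTuples k n r, f x = 0) →
      ∀ x ∈ commTuples k n r, f x = 0 := by
    intro f hf hf0 x hx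
    have : Nontrivial (Fin n → k) :=
      have : Nonempty (Fin n) := ⟨⟨0, by omega⟩⟩
      inferInstance
    have hev : ∀ i, ∃ c : k, ¬ IsUnit (x i - Matrix.scalar (Fin n) c) := fun i => by
      obtain ⟨c, hc⟩ := Module.End.exists_eigenvalue (Matrix.toLinAlgEquiv' (x i))
      have hc' := hc.mem_spectrum
      rw [AlgEquiv.spectrum_eq, spectrum.mem_iff] at hc'
      exact ⟨c, fun h => hc' (by
        simpa [Matrix.algebraMap_eq_diagonal, Pi.algebraMap_def] using h.neg)⟩
    choose c hc using hev
    by_cases hall : ∀ i, IsNilpotent (x i - Matrix.scalar (Fin n) (c i))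
    · exact eq_zero_of_isNilpotent_sub_scalar (by omega) hnil hf hf0 hx c hall
    · push Not at hall
      obtain ⟨j, hj⟩ := hall
      obtain ⟨m, m', P, Q, a, b, hm, hm', hmn, hPQ, hQP, ha, hb, hab⟩ :=
        exists_block_decomposition hx (z := x j - Matrix.scalar (Fin n) (c j))
          (fun i => Commute.sub_right (hx i j)
            (Matrix.scalar_commute _ (fun _ => Commute.all _ _) _).symm) (hc j) hj
      rw [funext hab]
      exact eq_zero_of_blocks (by omega) hmn (h m hm (by omega)) (h m' hm' (by omega)) hf hf0
        hPQ hQP ha hb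
  refine isIrreducible_matTupleZariski_iff.2 ⟨⟨fun _ => 0, fun _ _ => rfl⟩,
    fun f hf g hg hfg => ?_⟩
  exact (polyTuples_mul_eq_zero hf hg fun x hx => hfg x (polyTuples_subset_commTuples hx)).imp
    (hvanish f hf) (hvanish g hg)
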